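/- (A posteriori stability of BQCE.) Let γ : ℤ → [0,1] be N-periodic with α_ξ := (γ_ξ + γ_{ξ−1})/2 and β_ξ := 1 − (γ_{ξ+1} + γ_{ξ−1})/2, let y ∈ 𝒴 with min_ξ y'_ξ ≥ r*/2 > 0, and set C̄_i := C_i(2 min_ξ y'_ξ). Then c(y) ≥ c_γ(y) − 2C̄₂ max_ξ |Δ²α_ξ| − 2εC̄₃ max_ξ |Δβ_ξ · y''_ξ| − 2ε² ( C̄₃ max_ξ |(1−β_{ξ−1}) y'''_ξ| + C̄₄ max_ξ |(1−β_ξ)(y''_ξ)²| ). -/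

import Mathlib

open scoped BigOperators ENNReal
open Finset

noncomputable section

/-- The lattice spacing `ε = 1/N`. -/
def eps (N : ℕ) : ℝ := (N : ℝ)⁻¹

/-- `u : ℤ → ℝ` is `N`-periodic. -/
def IsPeriodic (N : ℕ) (u : ℤ → ℝ) : Prop := ∀ ξ : ℤ, u (ξ + N) = u ξ

/-- Membership in the space `𝒰` of `N`-periodic mean-zero displacements. -/
def inU (N : ℕ) (u : ℤ → ℝ) : Prop :=
  IsPeriodic N u ∧ ∑ ξ ∈ Finset.Icc (1 : ℤ) (N : ℤ), u ξ = 0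

/-- The uniform deformation `y^F_ξ = F ε ξ`. -/
def yUnif (N : ℕ) (F : ℝ) : ℤ → ℝ := fun ξ => F * eps N * ξ

/-- Membership in the space `𝒴` of admissible deformations. -/
def inY (N : ℕ) (y : ℤ → ℝ) : Prop :=
  ∃ F : ℝ, 0 < F ∧ ∃ u : ℤ → ℝ, inU N u ∧ y = fun ξ => yUnif N F ξ + u ξ

/-- The discrete first derivative `y'_ξ = (y_ξ - y_{ξ-1})/ε`. -/
def d1 (N : ℕ) (y : ℤ → ℝ) (ξ : ℤ) : ℝ := (y ξ - y (ξ - 1)) / eps N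

/-- The discrete second derivative `y''_ξ`. -/
def d2 (N : ℕ) (y : ℤ → ℝ) (ξ : ℤ) : ℝ :=
  (y (ξ + 1) - 2 * y ξ + y (ξ - 1)) / (eps N) ^ 2

/-- The discrete third derivative `y'''_ξ`. -/
def d3 (N : ℕ) (y : ℤ → ℝ) (ξ : ℤ) : ℝ :=
  (y (ξ + 1) - 3 * y ξ + 3 * y (ξ - 1) - y (ξ - 2)) / (eps N) ^ 3

/-- The BQC energy `Φ_{α,β}`. -/
def PhiBQC (N : ℕ) (φ : ℝ → ℝ) (α β : ℤ → ℝ) (y : ℤ → ℝ) : ℝ :=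
  eps N * ∑ ξ ∈ Finset.Icc (1 : ℤ) (N : ℤ),
    (φ (d1 N y ξ) + α ξ * φ (2 * d1 N y ξ) + β ξ * φ (d1 N y ξ + d1 N y (ξ + 1)))

/-- The BQNL energy with blending function `η`. -/
def PhiBQNL (N : ℕ) (φ : ℝ → ℝ) (η : ℤ → ℝ) : (ℤ → ℝ) → ℝ :=
  PhiBQC N φ (fun ξ => 1 - (η ξ + η (ξ - 1)) / 2) η

/-- The BQCE energy with blending function `γ`. -/
def PhiBQCE (N : ℕ) (φ : ℝ → ℝ) (γ : ℤ → ℝ) : (ℤ → ℝ) → ℝ :=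
  PhiBQC N φ (fun ξ => (γ ξ + γ (ξ - 1)) / 2) (fun ξ => 1 - (γ (ξ + 1) + γ (ξ - 1)) / 2)

/-- The atomistic energy `Φ`. -/
def PhiAt (N : ℕ) (φ : ℝ → ℝ) (y : ℤ → ℝ) : ℝ :=
  eps N * ∑ ξ ∈ Finset.Icc (1 : ℤ) (N : ℤ),
    (φ (d1 N y ξ) + φ (d1 N y ξ + d1 N y (ξ + 1)))

/-- The first variation `δΨ(y)[u] = (d/dt)|_{t=0} Ψ(y+tu)`. -/
def fvar (Ψ : (ℤ → ℝ) → ℝ) (y u : ℤ → ℝ) : ℝ :=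
  deriv (fun t : ℝ => Ψ (fun ξ => y ξ + t * u ξ)) 0

/-- The second variation `δ²Ψ(y)[u,u] = (d²/dt²)|_{t=0} Ψ(y+tu)`. -/
def svar (Ψ : (ℤ → ℝ) → ℝ) (y u : ℤ → ℝ) : ℝ :=
  iteratedDeriv 2 (fun t : ℝ => Ψ (fun ξ => y ξ + t * u ξ)) 0

/-- `max_ξ |v_ξ|` (for a periodic sequence this is a genuine maximum). -/
def supAbs (v : ℤ → ℝ) : ℝ := sSup (Set.range fun ξ => |v ξ|)

/-- `min_ξ y'_ξ` (for an admissible deformation this is a genuine minimum). -/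
def infD1 (N : ℕ) (y : ℤ → ℝ) : ℝ := sInf (Set.range fun ξ => d1 N y ξ)

/-- The constant `C_i(r₀) = sup_{r ≥ r₀} |φ^(i)(r)|`. -/
def Cbound (φ : ℝ → ℝ) (i : ℕ) (r₀ : ℝ) : ℝ :=
  sSup ((fun r => |iteratedDeriv i φ r|) '' Set.Ici r₀)

/-- The `ℓ^p_ε` norm over one period, `p ∈ [1,∞]`. -/
def lpnorm (N : ℕ) (p : ℝ≥0∞) (v : ℤ → ℝ) : ℝ :=
  if p = ⊤ then supAbs v
  else (eps N * ∑ ξ ∈ Finset.Icc (1 : ℤ) (N : ℤ), |v ξ| ^ p.toReal) ^ (1 / p.toReal)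

/-- The Hessian coefficient `A_ξ` of the atomistic energy. -/
def Acoef (N : ℕ) (φ : ℝ → ℝ) (y : ℤ → ℝ) (ξ : ℤ) : ℝ :=
  iteratedDeriv 2 φ (d1 N y ξ) + 2 * iteratedDeriv 2 φ (d1 N y ξ + d1 N y (ξ + 1))
    + 2 * iteratedDeriv 2 φ (d1 N y (ξ - 1) + d1 N y ξ)

/-- The Hessian coefficient `Ā_ξ` of the BQC energy. -/
def AbarCoef (N : ℕ) (φ : ℝ → ℝ) (α β : ℤ → ℝ) (y : ℤ → ℝ) (ξ : ℤ) : ℝ :=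
  iteratedDeriv 2 φ (d1 N y ξ) + 2 * β ξ * iteratedDeriv 2 φ (d1 N y ξ + d1 N y (ξ + 1))
    + 2 * β (ξ - 1) * iteratedDeriv 2 φ (d1 N y (ξ - 1) + d1 N y ξ)
    + 4 * α ξ * iteratedDeriv 2 φ (2 * d1 N y ξ)

/-- The coercivity constant `inf { δ²Ψ(y)[u,u] : u ∈ 𝒰, ‖u'‖_{ℓ²_ε} = 1 }`. -/
def coercConst (N : ℕ) (Ψ : (ℤ → ℝ) → ℝ) (y : ℤ → ℝ) : ℝ :=
  sInf { c : ℝ | ∃ u : ℤ → ℝ, inU N u ∧ lpnorm N 2 (d1 N u) = 1 ∧ c = svar Ψ y u }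

end

theorem eps_pos {N : ℕ} (hN : 0 < N) : 0 < eps N := by
  unfold eps; positivity

section Periodic

variable {N : ℕ} {u v : ℤ → ℝ}

theorem IsPeriodic.shift (hu : IsPeriodic N u) (k : ℤ) : IsPeriodic N fun ξ => u (ξ + k) := by
  intro ξ
  simpa only [add_right_comm] using hu (ξ + k)

theorem IsPeriodic.finite_range (hN : 0 < N) (hu : IsPeriodic N u) : (Set.range u).Finite := by
  have hNz : (0 : ℤ) < N := by exact_mod_cast hN
  have hp : Function.Periodic u (N : ℤ) := hu
  refine ((Set.finite_Ico (0 : ℤ) N).image u).subset ?_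
  rintro _ ⟨ξ, rfl⟩
  refine ⟨ξ % N, ⟨Int.emod_nonneg _ hNz.ne', Int.emod_lt_of_pos _ hNz⟩, ?_⟩
  have h := hp.int_mul (ξ / N) (ξ % N)
  rw [← h]
  congr 1
  have := Int.emod_add_mul_ediv ξ N
  push_cast
  linarith [mul_comm (N : ℤ) (ξ / N)]

theorem IsPeriodic.abs_le_supAbs (hN : 0 < N) (hv : IsPeriodic N v) (ξ : ℤ) :
    |v ξ| ≤ supAbs v := by
  have habs : IsPeriodic N fun ξ => |v ξ| := fun ξ => by simp only [hv ξ]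
  exact le_csSup (habs.finite_range hN).bddAbove ⟨ξ, rfl⟩

theorem supAbs_nonneg (v : ℤ → ℝ) : 0 ≤ supAbs v :=
  Real.sSup_nonneg (by rintro _ ⟨ξ, rfl⟩; exact abs_nonneg _)

theorem sum_Icc_shift_sub (f : ℤ → ℝ) (N : ℕ) :
    ∑ ξ ∈ Icc (1 : ℤ) N, f (ξ + 1) - ∑ ξ ∈ Icc (1 : ℤ) N, f ξ = f (N + 1) - f 1 := by
  induction N with
  | zero => simp
  | succ n ih =>
    have h : Icc (1 : ℤ) ((n + 1 : ℕ) : ℤ) = insert ((n : ℤ) + 1) (Icc (1 : ℤ) n) := by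
      ext x; simp only [mem_Icc, mem_insert]; push_cast; omega
    rw [h, sum_insert (by simp), sum_insert (by simp)]
    push_cast
    linarith

theorem IsPeriodic.sum_shift (hu : IsPeriodic N u) :
    ∑ ξ ∈ Icc (1 : ℤ) N, u (ξ + 1) = ∑ ξ ∈ Icc (1 : ℤ) N, u ξ := by
  have h := sum_Icc_shift_sub u N
  have h1 := hu 1
  rw [add_comm] at h1
  linarith

theorem IsPeriodic.d1 (hu : IsPeriodic N u) : IsPeriodic N (d1 N u) := by
  intro ξ
  have h := hu.shift (-1) ξ
  simp only [← sub_eq_add_neg] at h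
  simp only [_root_.d1, hu ξ, h]

theorem inY.isPeriodic_d1 (hN : 0 < N) (hy : inY N v) : IsPeriodic N (_root_.d1 N v) := by
  obtain ⟨F, -, u, ⟨hu, -⟩, rfl⟩ := hy
  intro ξ
  have h := hu.d1 ξ
  simp only [_root_.d1, yUnif] at h ⊢
  have hε := (eps_pos hN).ne'
  field_simp at h ⊢
  push_cast
  linarith

theorem d2_eq (hN : 0 < N) (y : ℤ → ℝ) (ξ : ℤ) :
    d2 N y ξ = (d1 N y (ξ + 1) - d1 N y ξ) / eps N := by
  have hε := (eps_pos hN).ne'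
  simp only [d2, d1, add_sub_cancel_right]
  field_simp
  ring

theorem d3_eq (hN : 0 < N) (y : ℤ → ℝ) (ξ : ℤ) :
    d3 N y ξ = (d2 N y ξ - d2 N y (ξ - 1)) / eps N := by
  have hε := (eps_pos hN).ne'
  simp only [d3, d2, sub_add_cancel, show ξ - 1 - 1 = ξ - 2 by ring]
  field_simp
  ring

theorem inY.isPeriodic_d2 (hN : 0 < N) (hy : inY N v) : IsPeriodic N (d2 N v) := by
  intro ξ
  have h := hy.isPeriodic_d1 hN
  simp only [d2_eq hN, h ξ, h.shift 1 ξ]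

theorem inY.isPeriodic_d3 (hN : 0 < N) (hy : inY N v) : IsPeriodic N (d3 N v) := by
  intro ξ
  have h := hy.isPeriodic_d2 hN
  have h1 := h.shift (-1) ξ
  simp only [← sub_eq_add_neg] at h1
  simp only [d3_eq hN, h ξ, h1]

theorem inY.infD1_le (hN : 0 < N) (hy : inY N v) (ξ : ℤ) : infD1 N v ≤ _root_.d1 N v ξ :=
  csInf_le ((hy.isPeriodic_d1 hN).finite_range hN).bddBelow ⟨ξ, rfl⟩

theorem eps_mul_sum_sq_of_lpnorm_two_eq_one (h : lpnorm N 2 v = 1) :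
    eps N * ∑ ξ ∈ Icc (1 : ℤ) N, v ξ ^ 2 = 1 := by
  simp only [lpnorm, ENNReal.ofNat_ne_top, if_false, ENNReal.toReal_ofNat, Real.rpow_ofNat,
    sq_abs, ← Real.sqrt_eq_rpow] at h
  exact Real.sqrt_eq_one.1 h

end Periodic

theorem Cbound_nonneg (φ : ℝ → ℝ) (i : ℕ) (r₀ : ℝ) : 0 ≤ Cbound φ i r₀ :=
  Real.sSup_nonneg (by rintro _ ⟨r, -, rfl⟩; exact abs_nonneg _)

section Smooth

variable {φ : ℝ → ℝ}

theorem ContDiffOn.hasDerivAt_iteratedDeriv {n : ℕ} (hφ : ContDiffOn ℝ n φ (Set.Ioi 0))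
    {i : ℕ} (hi : i < n) {x : ℝ} (hx : 0 < x) :
    HasDerivAt (iteratedDeriv i φ) (iteratedDeriv (i + 1) φ x) x := by
  have h := (hφ.differentiableOn_iteratedDerivWithin (m := i) (by exact_mod_cast hi)
    isOpen_Ioi.uniqueDiffOn).differentiableAt (Ioi_mem_nhds hx)
  have hev : iteratedDeriv i φ =ᶠ[nhds x] iteratedDerivWithin i φ (Set.Ioi 0) := by
    filter_upwards [Ioi_mem_nhds hx] with z hz
    exact (iteratedDerivWithin_of_isOpen isOpen_Ioi hz).symm
  rw [iteratedDeriv_succ]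
  exact (hev.symm.differentiableAt_iff.1 h).hasDerivAt

theorem contDiffAt_comp_affine {n : ℕ} (hφ : ContDiffOn ℝ n φ (Set.Ioi 0)) {a : ℝ} (ha : 0 < a)
    (b : ℝ) : ContDiffAt ℝ n (fun t => φ (a + t * b)) 0 := by
  have h : ContDiffAt ℝ n φ (a + 0 * b) := by
    simpa using hφ.contDiffAt (Ioi_mem_nhds ha)
  exact h.comp (0 : ℝ) (f := fun t : ℝ => a + t * b) (by fun_prop)

theorem iteratedDeriv_two_comp_affine (hφ : ContDiffOn ℝ (2 : ℕ) φ (Set.Ioi 0)) {a : ℝ}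
    (ha : 0 < a) (b : ℝ) :
    iteratedDeriv 2 (fun t => φ (a + t * b)) 0 = iteratedDeriv 2 φ a * b ^ 2 := by
  have haff : ∀ t : ℝ, HasDerivAt (fun t => a + t * b) b t := fun t => by
    simpa using ((hasDerivAt_id t).mul_const b).const_add a
  have hpos : ∀ᶠ t in nhds (0 : ℝ), 0 < a + t * b := by
    have hc : ContinuousAt (fun t => a + t * b) 0 := (haff 0).continuousAt
    exact hc.eventually (Ioi_mem_nhds (by simpa using ha))
  have hderiv : deriv (fun t => φ (a + t * b)) =ᶠ[nhds 0]
      fun t => iteratedDeriv 1 φ (a + t * b) * b := by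
    filter_upwards [hpos] with t ht
    have h := hφ.hasDerivAt_iteratedDeriv (i := 0) (by norm_num) ht
    rw [iteratedDeriv_zero] at h
    exact (h.comp t (haff t)).deriv
  rw [iteratedDeriv_succ, iteratedDeriv_one, hderiv.deriv_eq]
  have h := hφ.hasDerivAt_iteratedDeriv (i := 1) (by norm_num) (x := a + 0 * b) (by simpa using ha)
  have h' := ((h.comp 0 (haff 0)).mul_const b).deriv
  simp only [Function.comp_def] at h'
  rw [h']
  norm_num
  ring

theorem abs_sub_sub_mul_le_of_abs_deriv_two_le {f f' f'' : ℝ → ℝ} {r₀ C x z : ℝ}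
    (hf : ∀ r, r₀ ≤ r → HasDerivAt f (f' r) r) (hf' : ∀ r, r₀ ≤ r → HasDerivAt f' (f'' r) r)
    (hC : ∀ r, r₀ ≤ r → |f'' r| ≤ C) (hx : r₀ ≤ x) (hz : r₀ ≤ z) :
    |f z - f x - f' x * (z - x)| ≤ C / 2 * (z - x) ^ 2 := by
  have hseg : ∀ t ∈ Set.Icc (0 : ℝ) 1, r₀ ≤ x + t * (z - x) := by
    rintro t ⟨h0, h1⟩
    nlinarith
  have haff : ∀ t : ℝ, HasDerivAt (fun t => x + t * (z - x)) (z - x) t := fun t => by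
    simpa using ((hasDerivAt_id t).mul_const (z - x)).const_add x
  have hg : ∀ t ∈ Set.Icc (0 : ℝ) 1,
      HasDerivAt (fun t => f (x + t * (z - x)) - f x - t * (f' x * (z - x)))
        (f' (x + t * (z - x)) * (z - x) - f' x * (z - x)) t := fun t ht => by
    have h := ((hf _ (hseg t ht)).comp t (haff t)).sub_const (f x)
    have h' := h.sub ((hasDerivAt_id t).mul_const (f' x * (z - x)))
    rw [one_mul] at h'
    exact h'
  have hB : ∀ t : ℝ, HasDerivAt (fun t => C / 2 * (z - x) ^ 2 * t ^ 2) (C * (z - x) ^ 2 * t) t := by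
    intro t
    have h := (hasDerivAt_pow 2 t).const_mul (C / 2 * (z - x) ^ 2)
    refine h.congr_deriv ?_
    push_cast
    ring
  have key := image_norm_le_of_norm_deriv_right_le_deriv_boundary (a := (0 : ℝ)) (b := 1)
    (fun t ht => (hg t ht).continuousAt.continuousWithinAt)
    (fun t ht => (hg t (Set.Ico_subset_Icc_self ht)).hasDerivWithinAt)
    (by simp) hB ?_ (Set.right_mem_Icc.2 zero_le_one)
  · simpa using key
  · intro t ht
    have hlip := (convex_Ici r₀).norm_image_sub_le_of_norm_hasDerivWithin_le
      (fun r hr => (hf' r hr).hasDerivWithinAt) (fun r hr => hC r hr) hx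
      (hseg t (Set.Ico_subset_Icc_self ht))
    rw [← sub_mul, norm_mul]
    calc _ ≤ C * ‖x + t * (z - x) - x‖ * ‖z - x‖ := by gcongr
      _ = C * (z - x) ^ 2 * t := by
        rw [add_sub_cancel_left, norm_mul, Real.norm_of_nonneg ht.1, mul_assoc, mul_assoc,
          ← sq, Real.norm_eq_abs, sq_abs]
        ring

theorem svar_PhiBQC {N : ℕ} (hφ : ContDiffOn ℝ (2 : ℕ) φ (Set.Ioi 0)) (α β : ℤ → ℝ)
    {y : ℤ → ℝ} (hy : ∀ ξ, 0 < d1 N y ξ) (u : ℤ → ℝ) :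
    svar (PhiBQC N φ α β) y u = eps N * ∑ ξ ∈ Icc (1 : ℤ) N,
      (iteratedDeriv 2 φ (d1 N y ξ) * d1 N u ξ ^ 2
        + α ξ * (iteratedDeriv 2 φ (2 * d1 N y ξ) * (2 * d1 N u ξ) ^ 2)
        + β ξ * (iteratedDeriv 2 φ (d1 N y ξ + d1 N y (ξ + 1))
            * (d1 N u ξ + d1 N u (ξ + 1)) ^ 2)) := by
  have hd : ∀ (t : ℝ) (ξ : ℤ), d1 N (fun ξ => y ξ + t * u ξ) ξ = d1 N y ξ + t * d1 N u ξ := by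
    intro t ξ
    simp only [d1]
    ring
  have hfun : (fun t : ℝ => PhiBQC N φ α β (fun ξ => y ξ + t * u ξ)) = fun t =>
      eps N * ∑ ξ ∈ Icc (1 : ℤ) N, (φ (d1 N y ξ + t * d1 N u ξ)
        + α ξ * φ (2 * d1 N y ξ + t * (2 * d1 N u ξ))
        + β ξ * φ (d1 N y ξ + d1 N y (ξ + 1) + t * (d1 N u ξ + d1 N u (ξ + 1)))) := by
    funext t
    simp only [PhiBQC, hd]
    congr 1
    refine sum_congr rfl fun ξ _ => ?_
    rw [show 2 * (d1 N y ξ + t * d1 N u ξ) = 2 * d1 N y ξ + t * (2 * d1 N u ξ) by ring,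
      show d1 N y ξ + t * d1 N u ξ + (d1 N y (ξ + 1) + t * d1 N u (ξ + 1))
        = d1 N y ξ + d1 N y (ξ + 1) + t * (d1 N u ξ + d1 N u (ξ + 1)) by ring]
  have h1 := fun ξ => contDiffAt_comp_affine hφ (hy ξ) (d1 N u ξ)
  have h2 := fun ξ => (contDiffAt_const (c := α ξ)).mul
    (contDiffAt_comp_affine hφ (mul_pos two_pos (hy ξ)) (2 * d1 N u ξ))
  have h3 := fun ξ => (contDiffAt_const (c := β ξ)).mul
    (contDiffAt_comp_affine hφ (add_pos (hy ξ) (hy (ξ + 1))) (d1 N u ξ + d1 N u (ξ + 1)))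
  rw [svar, hfun, iteratedDeriv_const_mul_field,
    iteratedDeriv_fun_sum fun ξ _ => ((h1 ξ).add (h2 ξ)).add (h3 ξ)]
  congr 1
  refine sum_congr rfl fun ξ _ => ?_
  rw [iteratedDeriv_fun_add ((h1 ξ).add (h2 ξ)) (h3 ξ), iteratedDeriv_fun_add (h1 ξ) (h2 ξ),
    iteratedDeriv_const_mul_field, iteratedDeriv_const_mul_field,
    iteratedDeriv_two_comp_affine hφ (hy ξ),
    iteratedDeriv_two_comp_affine hφ (mul_pos two_pos (hy ξ)),
    iteratedDeriv_two_comp_affine hφ (add_pos (hy ξ) (hy (ξ + 1)))]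

theorem PhiAt_eq_PhiBQC (N : ℕ) (φ : ℝ → ℝ) :
    PhiAt N φ = PhiBQC N φ (fun _ => 0) (fun _ => 1) := by
  funext y
  simp [PhiAt, PhiBQC]

end Smooth

section Coercivity

variable {N : ℕ} {φ : ℝ → ℝ} {y : ℤ → ℝ}

theorem abs_le_Cbound {i : ℕ} {r₀ r : ℝ}
    (hC : BddAbove ((fun r => |iteratedDeriv i φ r|) '' Set.Ici r₀)) (hr : r₀ ≤ r) :
    |iteratedDeriv i φ r| ≤ Cbound φ i r₀ :=
  le_csSup hC ⟨r, hr, rfl⟩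

/-- The algebra behind the comparison of the Hessian coefficients of the atomistic and BQC
energies: `P`, `M` are the second-neighbour stiffnesses to the right and left, and `s`, `f₃` the
second and third derivatives of the potential at the local Cauchy–Born strain. -/
theorem neg_le_stiffness_sub {a b α P M s f₃ e d d' C₂ C₃ C₄ S₁ S₂ T Q : ℝ}
    (he : 0 < e) (ha : 0 ≤ a) (hb : 0 ≤ b) (hC₂ : 0 ≤ C₂) (hC₃ : 0 ≤ C₃) (hC₄ : 0 ≤ C₄)
    (hP : |P - s - f₃ * (e * d)| ≤ C₄ / 2 * (e * d) ^ 2)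
    (hM : |M - s - f₃ * (-(e * d'))| ≤ C₄ / 2 * (-(e * d')) ^ 2)
    (hs : |s| ≤ C₂) (hf₃ : |f₃| ≤ C₃) (hS₂ : |a + b - 2 * α| ≤ S₂)
    (hS₁ : |(b - a) * d| ≤ S₁) (hT : |b * ((d - d') / e)| ≤ T)
    (hQ : a * d ^ 2 ≤ Q) (hQ' : b * d' ^ 2 ≤ Q) :
    -(2 * C₂ * S₂ + 2 * e * C₃ * S₁ + 2 * e ^ 2 * (C₃ * T + C₄ * Q))
      ≤ 2 * a * P + 2 * b * M - 4 * α * s := by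
  have h₂ : -(C₂ * S₂) ≤ s * (a + b - 2 * α) :=
    neg_le_of_abs_le (by rw [abs_mul]; gcongr)
  have h₁ : f₃ * ((b - a) * d) ≤ C₃ * S₁ := le_of_abs_le (by rw [abs_mul]; gcongr)
  have h₃ : -(C₃ * T) ≤ f₃ * (b * ((d - d') / e)) :=
    neg_le_of_abs_le (by rw [abs_mul]; gcongr)
  have hP' := mul_le_mul_of_nonneg_left (neg_le_of_abs_le hP) ha
  have hM' := mul_le_mul_of_nonneg_left (neg_le_of_abs_le hM) hb
  have hCQ := mul_le_mul_of_nonneg_left hQ (mul_nonneg hC₄ (sq_nonneg e))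
  have hCQ' := mul_le_mul_of_nonneg_left hQ' (mul_nonneg hC₄ (sq_nonneg e))
  have h₁' := mul_le_mul_of_nonneg_left h₁ he.le
  have h₃' := mul_le_mul_of_nonneg_left h₃ (sq_nonneg e)
  have hdiv : e ^ 2 * (f₃ * (b * ((d - d') / e))) = e * f₃ * b * (d - d') := by
    field_simp
  rw [hdiv] at h₃'
  nlinarith

/-- The second variation of the BQC energy is bounded below on the unit sphere. -/
theorem neg_le_svar_PhiBQC (hφ : ContDiffOn ℝ (2 : ℕ) φ (Set.Ioi 0)) {α β : ℤ → ℝ}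
    (hα : ∀ ξ, α ξ ∈ Set.Icc (0 : ℝ) 1) (hβ : ∀ ξ, β ξ ∈ Set.Icc (0 : ℝ) 1) {r M : ℝ} (hr : 0 < r)
    (hy : ∀ ξ, r ≤ d1 N y ξ) (hM : ∀ s, r ≤ s → |iteratedDeriv 2 φ s| ≤ M)
    {u : ℤ → ℝ} (hu : IsPeriodic N u) (hu1 : lpnorm N 2 (d1 N u) = 1) :
    -(9 * M) ≤ svar (PhiBQC N φ α β) y u := by
  have hsum := eps_mul_sum_sq_of_lpnorm_two_eq_one hu1
  have hsq : IsPeriodic N fun ξ => d1 N u ξ ^ 2 := fun ξ => by simp only [hu.d1 ξ]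
  have hε : 0 ≤ eps N := by unfold eps; positivity
  have hM0 : 0 ≤ M := (abs_nonneg _).trans (hM r le_rfl)
  have hweight : ∀ w k s : ℝ, w ∈ Set.Icc (0 : ℝ) 1 → r ≤ s →
      -(M * k ^ 2) ≤ w * (iteratedDeriv 2 φ s * k ^ 2) := by
    rintro w k s ⟨hw0, hw1⟩ hs
    apply neg_le_of_abs_le
    rw [abs_mul, abs_mul, abs_of_nonneg hw0, abs_sq]
    calc _ ≤ 1 * (M * k ^ 2) := by gcongr; exact hM s hs
      _ = _ := one_mul _
  rw [svar_PhiBQC hφ α β fun ξ => hr.trans_le (hy ξ)]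
  have hlow : -(9 * M) = eps N * ∑ ξ ∈ Icc (1 : ℤ) N,
      (-(7 * M) * d1 N u ξ ^ 2 + -(2 * M) * d1 N u (ξ + 1) ^ 2) := by
    rw [sum_add_distrib, ← mul_sum, ← mul_sum, hsq.sum_shift]
    linear_combination 9 * M * hsum
  rw [hlow]
  refine mul_le_mul_of_nonneg_left (sum_le_sum fun ξ _ => ?_) hε
  have h1 := hweight 1 (d1 N u ξ) _ (by simp) (hy ξ)
  have h2 := hweight (α ξ) (2 * d1 N u ξ) (2 * d1 N y ξ) (hα ξ) (by linarith [hy ξ])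
  have h3 := hweight (β ξ) (d1 N u ξ + d1 N u (ξ + 1)) (d1 N y ξ + d1 N y (ξ + 1)) (hβ ξ)
    (by linarith [hy ξ, hy (ξ + 1)])
  nlinarith [mul_nonneg hM0 (sq_nonneg (d1 N u ξ - d1 N u (ξ + 1)))]

/-- If the second-neighbour stiffnesses are nonpositive, a lower bound `-K` on the difference of
the Hessian coefficients bounds the difference of the second variations on the unit sphere. -/
theorem svar_PhiBQC_sub_le_svar_PhiAt (hφ : ContDiffOn ℝ (2 : ℕ) φ (Set.Ioi 0)) {α β : ℤ → ℝ}
    (hβper : IsPeriodic N β) (hβ : ∀ ξ, β ξ ≤ 1) (hy : ∀ ξ, 0 < d1 N y ξ)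
    (hyper : IsPeriodic N (d1 N y))
    (hneg : ∀ ξ, iteratedDeriv 2 φ (d1 N y ξ + d1 N y (ξ + 1)) ≤ 0) {K : ℝ}
    (hK : ∀ ξ, -K ≤ Acoef N φ y ξ - AbarCoef N φ α β y ξ)
    {u : ℤ → ℝ} (hu : IsPeriodic N u) (hu1 : lpnorm N 2 (d1 N u) = 1) :
    svar (PhiBQC N φ α β) y u - K ≤ svar (PhiAt N φ) y u := by
  have hsum := eps_mul_sum_sq_of_lpnorm_two_eq_one hu1
  have hε : 0 ≤ eps N := by unfold eps; positivity
  rw [PhiAt_eq_PhiBQC, svar_PhiBQC hφ α β hy, svar_PhiBQC hφ _ _ hy]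
  set f : ℤ → ℝ := fun ξ =>
    2 * (1 - β (ξ - 1)) * iteratedDeriv 2 φ (d1 N y (ξ - 1) + d1 N y ξ) * d1 N u ξ ^ 2 with hf
  have hfper : IsPeriodic N f := by
    intro ξ
    have h1 := hβper.shift (-1) ξ
    have h2 := hyper.shift (-1) ξ
    simp only [← sub_eq_add_neg] at h1 h2
    simp only [hf, h1, h2, hyper ξ, hu.d1 ξ]
  have hshift := hfper.sum_shift
  have hKsum : -K ≤ eps N * ∑ ξ ∈ Icc (1 : ℤ) N,
      (Acoef N φ y ξ - AbarCoef N φ α β y ξ) * d1 N u ξ ^ 2 := by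
    calc -K = eps N * ∑ ξ ∈ Icc (1 : ℤ) N, -K * d1 N u ξ ^ 2 := by
          rw [← mul_sum]; linear_combination K * hsum
      _ ≤ _ := by gcongr with ξ; exact hK ξ
  have hsplit : ∑ ξ ∈ Icc (1 : ℤ) N, (Acoef N φ y ξ - AbarCoef N φ α β y ξ) * d1 N u ξ ^ 2
      = ∑ ξ ∈ Icc (1 : ℤ) N, ((Acoef N φ y ξ - AbarCoef N φ α β y ξ) * d1 N u ξ ^ 2
          - f ξ + f (ξ + 1)) := by
    rw [sum_add_distrib, sum_sub_distrib, hshift]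
    ring
  rw [hsplit] at hKsum
  rw [sub_le_iff_le_add, ← sub_le_iff_le_add', ← neg_le_neg_iff]
  refine hKsum.trans ?_
  rw [neg_sub, ← mul_sub, ← sum_sub_distrib]
  refine mul_le_mul_of_nonneg_left (sum_le_sum fun ξ _ => ?_) hε
  have h := mul_nonneg (mul_nonneg (sub_nonneg.2 (hβ ξ)) (neg_nonneg.2 (hneg ξ)))
    (sq_nonneg (d1 N u ξ - d1 N u (ξ + 1)))
  simp only [hf, Acoef, AbarCoef, add_sub_cancel_right]
  linarith

/-- Lower bound on the difference of the Hessian coefficients of the atomistic and BQCE energies. -/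
theorem neg_le_Acoef_sub_AbarCoef (hN : 0 < N) (hφ : ContDiffOn ℝ (4 : ℕ) φ (Set.Ioi 0))
    (hC : ∀ i ≤ 4, ∀ r₀ : ℝ, 0 < r₀ →
      BddAbove ((fun r => |iteratedDeriv i φ r|) '' Set.Ici r₀))
    {γ α β : ℤ → ℝ} (hγper : IsPeriodic N γ) (hγ : ∀ ξ, 0 ≤ γ ξ)
    (hα : α = fun ξ => (γ ξ + γ (ξ - 1)) / 2)
    (hβ : β = fun ξ => 1 - (γ (ξ + 1) + γ (ξ - 1)) / 2)
    (hy : inY N y) (hy' : 0 < infD1 N y) (ξ : ℤ) :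
    -(2 * Cbound φ 2 (2 * infD1 N y) * supAbs (fun ξ => α (ξ + 1) - 2 * α ξ + α (ξ - 1))
        + 2 * eps N * Cbound φ 3 (2 * infD1 N y) *
            supAbs (fun ξ => (β ξ - β (ξ - 1)) * d2 N y ξ)
        + 2 * (eps N) ^ 2 *
            (Cbound φ 3 (2 * infD1 N y) * supAbs (fun ξ => (1 - β (ξ - 1)) * d3 N y ξ)
              + Cbound φ 4 (2 * infD1 N y) *
                  supAbs (fun ξ => (1 - β ξ) * (d2 N y ξ) ^ 2)))
      ≤ Acoef N φ y ξ - AbarCoef N φ α β y ξ := by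
  set m := infD1 N y
  have hε := eps_pos hN
  have hle : ∀ ξ, m ≤ d1 N y ξ := hy.infD1_le hN
  have h2m : 0 < 2 * m := by linarith
  have hγ1 : ∀ ξ : ℤ, γ (ξ + N - 1) = γ (ξ - 1) := fun ξ => by
    simpa only [← sub_eq_add_neg] using hγper.shift (-1) ξ
  have hαper : IsPeriodic N α := fun ξ => by simp only [hα, hγper ξ, hγ1]
  have hβper : IsPeriodic N β := fun ξ => by simp only [hβ, hγ1, hγper.shift 1 ξ]
  have hα1 : ∀ ξ : ℤ, α (ξ + N - 1) = α (ξ - 1) := fun ξ => by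
    simpa only [← sub_eq_add_neg] using hαper.shift (-1) ξ
  have hβ1 : ∀ ξ : ℤ, β (ξ + N - 1) = β (ξ - 1) := fun ξ => by
    simpa only [← sub_eq_add_neg] using hβper.shift (-1) ξ
  have hβ0 : ∀ ξ, 0 ≤ 1 - β ξ := fun ξ => by
    simp only [hβ]; linarith [hγ (ξ + 1), hγ (ξ - 1)]
  have hd2 := hy.isPeriodic_d2 hN
  have hd3 := hy.isPeriodic_d3 hN
  have hS₂ := IsPeriodic.abs_le_supAbs hN
    (v := fun ξ => α (ξ + 1) - 2 * α ξ + α (ξ - 1))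
    (fun ξ => by simp only [hαper ξ, hα1, hαper.shift 1 ξ]) ξ
  have hS₁ := IsPeriodic.abs_le_supAbs hN (v := fun ξ => (β ξ - β (ξ - 1)) * d2 N y ξ)
    (fun ξ => by simp only [hβper ξ, hβ1, hd2 ξ]) ξ
  have hT := IsPeriodic.abs_le_supAbs hN (v := fun ξ => (1 - β (ξ - 1)) * d3 N y ξ)
    (fun ξ => by simp only [hβ1, hd3 ξ]) ξ
  have hQ := fun ζ => (le_abs_self _).trans <|
    IsPeriodic.abs_le_supAbs hN (v := fun ξ => (1 - β ξ) * (d2 N y ξ) ^ 2)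
      (fun ξ => by simp only [hβper ξ, hd2 ξ]) ζ
  have taylor : ∀ x z : ℝ, 2 * m ≤ x → 2 * m ≤ z →
      |iteratedDeriv 2 φ z - iteratedDeriv 2 φ x - iteratedDeriv 3 φ x * (z - x)|
        ≤ Cbound φ 4 (2 * m) / 2 * (z - x) ^ 2 := fun x z hx hz =>
    abs_sub_sub_mul_le_of_abs_deriv_two_le
      (fun r hr => hφ.hasDerivAt_iteratedDeriv (by norm_num) (h2m.trans_le hr))
      (fun r hr => hφ.hasDerivAt_iteratedDeriv (by norm_num) (h2m.trans_le hr))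
      (fun r hr => abs_le_Cbound (hC 4 le_rfl _ h2m) hr) hx hz
  have hx : 2 * m ≤ 2 * d1 N y ξ := by linarith [hle ξ]
  have hP := taylor _ (d1 N y ξ + d1 N y (ξ + 1)) hx (by linarith [hle ξ, hle (ξ + 1)])
  have hM := taylor _ (d1 N y (ξ - 1) + d1 N y ξ) hx (by linarith [hle ξ, hle (ξ - 1)])
  have hplus : d1 N y ξ + d1 N y (ξ + 1) - 2 * d1 N y ξ = eps N * d2 N y ξ := by
    rw [d2_eq hN]; field_simp; ring
  have hminus : d1 N y (ξ - 1) + d1 N y ξ - 2 * d1 N y ξ = -(eps N * d2 N y (ξ - 1)) := by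
    rw [d2_eq hN, sub_add_cancel]; field_simp; ring
  rw [hplus] at hP
  rw [hminus] at hM
  have hblend : α (ξ + 1) - 2 * α ξ + α (ξ - 1) = (1 - β ξ) + (1 - β (ξ - 1)) - 2 * α ξ := by
    simp only [hα, hβ, add_sub_cancel_right, sub_add_cancel]
    ring
  simp only [hblend] at hS₂
  have hS₁' : |((1 - β (ξ - 1)) - (1 - β ξ)) * d2 N y ξ|
      ≤ supAbs (fun ξ => (β ξ - β (ξ - 1)) * d2 N y ξ) := by
    convert hS₁ using 3
    ring
  simp only [d3_eq hN y ξ] at hT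
  have key := neg_le_stiffness_sub hε (hβ0 ξ) (hβ0 (ξ - 1)) (Cbound_nonneg _ _ _)
    (Cbound_nonneg _ _ _) (Cbound_nonneg _ _ _) hP hM
    (abs_le_Cbound (hC 2 (by norm_num) _ h2m) hx) (abs_le_Cbound (hC 3 (by norm_num) _ h2m) hx)
    hS₂ hS₁' hT (hQ ξ) (hQ (ξ - 1))
  refine key.trans_eq ?_
  simp only [Acoef, AbarCoef]
  ring

end Coercivity

/-- A posteriori stability of BQCE. -/
theorem aposteriori_stability_bqce
    (N : ℕ) (hN : 5 ≤ N) (φ : ℝ → ℝ) (hφ : ContDiffOn ℝ 4 φ (Set.Ioi 0))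
    (hC : ∀ i ≤ 4, ∀ r₀ : ℝ, 0 < r₀ →
      BddAbove ((fun r => |iteratedDeriv i φ r|) '' Set.Ici r₀))
    (rstar : ℝ) (hrstar : 0 < rstar)
    (hconvex : ∀ r : ℝ, 0 < r → r < rstar → 0 < iteratedDeriv 2 φ r)
    (hconcave : ∀ r : ℝ, rstar < r → iteratedDeriv 2 φ r < 0)
    (γ : ℤ → ℝ) (hγper : IsPeriodic N γ) (hγ01 : ∀ ξ, γ ξ ∈ Set.Icc (0 : ℝ) 1)
    (α β : ℤ → ℝ) (hα : α = fun ξ => (γ ξ + γ (ξ - 1)) / 2)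
    (hβ : β = fun ξ => 1 - (γ (ξ + 1) + γ (ξ - 1)) / 2)
    (y : ℤ → ℝ) (hy : inY N y) (hy' : rstar / 2 ≤ infD1 N y) :
    coercConst N (PhiBQCE N φ γ) y
        - 2 * Cbound φ 2 (2 * infD1 N y) * supAbs (fun ξ => α (ξ + 1) - 2 * α ξ + α (ξ - 1))
        - 2 * eps N * Cbound φ 3 (2 * infD1 N y) *
            supAbs (fun ξ => (β ξ - β (ξ - 1)) * d2 N y ξ)
        - 2 * (eps N) ^ 2 *
            (Cbound φ 3 (2 * infD1 N y) * supAbs (fun ξ => (1 - β (ξ - 1)) * d3 N y ξ)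
              + Cbound φ 4 (2 * infD1 N y) *
                  supAbs (fun ξ => (1 - β ξ) * (d2 N y ξ) ^ 2))
      ≤ coercConst N (PhiAt N φ) y := by
  have hN0 : 0 < N := by omega
  have hm : 0 < infD1 N y := by linarith
  have hle : ∀ ξ, infD1 N y ≤ d1 N y ξ := hy.infD1_le hN0
  have hpos : ∀ ξ, 0 < d1 N y ξ := fun ξ => hm.trans_le (hle ξ)
  have hφ2 : ContDiffOn ℝ (2 : ℕ) φ (Set.Ioi 0) := hφ.of_le (by norm_num)
  have hγ1 : ∀ ξ : ℤ, γ (ξ + N - 1) = γ (ξ - 1) := fun ξ => by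
    simpa only [← sub_eq_add_neg] using hγper.shift (-1) ξ
  have hβper : IsPeriodic N β := fun ξ => by simp only [hβ, hγ1, hγper.shift 1 ξ]
  have hα01 : ∀ ξ, α ξ ∈ Set.Icc (0 : ℝ) 1 := fun ξ => by
    have h := hγ01 ξ
    have h' := hγ01 (ξ - 1)
    simp only [hα, Set.mem_Icc] at h h' ⊢
    constructor <;> linarith
  have hβ01 : ∀ ξ, β ξ ∈ Set.Icc (0 : ℝ) 1 := fun ξ => by
    have h := hγ01 (ξ + 1)
    have h' := hγ01 (ξ - 1)
    simp only [hβ, Set.mem_Icc] at h h' ⊢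
    constructor <;> linarith
  have hnonpos : ∀ r, rstar ≤ r → iteratedDeriv 2 φ r ≤ 0 := by
    intro r hr
    have hr0 : 0 < r := hrstar.trans_le hr
    have hcont : ContinuousAt (iteratedDeriv 2 φ) r :=
      (ContDiffOn.hasDerivAt_iteratedDeriv (n := 4) hφ (by norm_num) hr0).continuousAt
    refine le_of_tendsto (hcont.tendsto.mono_left nhdsWithin_le_nhds :
      Filter.Tendsto _ (nhdsWithin r (Set.Ioi r)) _) ?_
    filter_upwards [self_mem_nhdsWithin] with s hs
    exact (hconcave s (hr.trans_lt hs)).le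
  have hcoerc : ∀ K, 0 ≤ K → (∀ ξ, -K ≤ Acoef N φ y ξ - AbarCoef N φ α β y ξ) →
      coercConst N (PhiBQC N φ α β) y - K ≤ coercConst N (PhiAt N φ) y := by
    intro K hK0 hK
    by_cases hne : ∃ u : ℤ → ℝ, inU N u ∧ lpnorm N 2 (d1 N u) = 1
    · refine le_csInf (by obtain ⟨u, hu, hu1⟩ := hne; exact ⟨_, u, hu, hu1, rfl⟩) ?_
      rintro _ ⟨u, hu, hu1, rfl⟩
      have hmem : coercConst N (PhiBQC N φ α β) y ≤ svar (PhiBQC N φ α β) y u := by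
        refine csInf_le ⟨-(9 * Cbound φ 2 (infD1 N y)), ?_⟩ ⟨u, hu, hu1, rfl⟩
        rintro _ ⟨v, hv, hv1, rfl⟩
        exact neg_le_svar_PhiBQC hφ2 hα01 hβ01 hm hle
          (fun s hs => abs_le_Cbound (hC 2 (by norm_num) _ hm) hs) hv.1 hv1
      exact (sub_le_sub_right hmem K).trans <|
        svar_PhiBQC_sub_le_svar_PhiAt hφ2 hβper (fun ξ => (hβ01 ξ).2) hpos (hy.isPeriodic_d1 hN0)
          (fun ξ => hnonpos _ (by linarith [hle ξ, hle (ξ + 1)])) hK hu.1 hu1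
    · have hempty : ∀ Ψ, coercConst N Ψ y = 0 := by
        intro Ψ
        rw [coercConst, ← Real.sInf_empty]
        congr 1
        refine Set.eq_empty_of_forall_notMem ?_
        rintro _ ⟨u, hu, hu1, -⟩
        exact hne ⟨u, hu, hu1⟩
      rw [hempty, hempty]
      linarith
  rw [show PhiBQCE N φ γ = PhiBQC N φ α β by rw [hα, hβ]; rfl, sub_sub, sub_sub, ← add_assoc]
  refine hcoerc _ ?_ fun ξ =>
    neg_le_Acoef_sub_AbarCoef hN0 hφ hC hγper (fun ξ => (hγ01 ξ).1) hα hβ hy hm ξ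
  have hε := (eps_pos hN0).le
  repeat' first
    | positivity
    | exact Cbound_nonneg _ _ _
    | exact supAbs_nonneg _
    | apply add_nonneg
    | apply mul_nonneg
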